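/- arXiv:2502.08330 — 8 statements merged into one kernel-verified Lean document; each statement's English description precedes it below -/
import Mathlib

section
/- Let E be a real normed vector space, let a > 0 and L > 0, let f : E → ℝ satisfy f(0) = 0 and f(x) ≥ a‖x‖² for all x ∈ E, and let p : E → ℝ satisfy p(x + y) ≤ p(x) + p(y) for all x, y, p(t•x) = t·p(x) for all t ≥ 0 and x, and 0 ≤ p(x) ≤ L‖x‖ for all x. Define the infimal convolution W(x) = ⨅_{y ∈ E} (f(x − y) + p(y)). Then for every ξ ∈ E, W(t•ξ)/t tends to p(ξ) as t → +∞; that is, the recession function of W is p. -/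
open Filter

section InfimalConvolution

variable {E : Type*} [NormedAddCommGroup E] {a L : ℝ} {f p : E → ℝ}

theorem le_add_of_quadratic_growth (ha : 0 < a) (hf : ∀ x, a * ‖x‖ ^ 2 ≤ f x)
    (hsub : ∀ x y, p (x + y) ≤ p x + p y) (hp_le : ∀ x, p x ≤ L * ‖x‖) (x y : E) :
    p x - L ^ 2 / (4 * a) ≤ f (x - y) + p y := by
  have hp : p x ≤ p (x - y) + p y := by simpa using hsub (x - y) y
  have young : L * ‖x - y‖ ≤ a * ‖x - y‖ ^ 2 + L ^ 2 / (4 * a) := by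
    have h : a * ‖x - y‖ ^ 2 + L ^ 2 / (4 * a) - L * ‖x - y‖
        = (2 * a * ‖x - y‖ - L) ^ 2 / (4 * a) := by
      field_simp
      ring
    have : 0 ≤ (2 * a * ‖x - y‖ - L) ^ 2 / (4 * a) := by positivity
    linarith
  linarith [hf (x - y), hp_le (x - y)]

theorem sub_le_infimal_convolution (ha : 0 < a) (hf : ∀ x, a * ‖x‖ ^ 2 ≤ f x)
    (hsub : ∀ x y, p (x + y) ≤ p x + p y) (hp_le : ∀ x, p x ≤ L * ‖x‖) (x : E) :
    p x - L ^ 2 / (4 * a) ≤ ⨅ y : E, (f (x - y) + p y) :=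
  le_ciInf (le_add_of_quadratic_growth ha hf hsub hp_le x)

theorem infimal_convolution_le (ha : 0 < a) (hf0 : f 0 = 0) (hf : ∀ x, a * ‖x‖ ^ 2 ≤ f x)
    (hsub : ∀ x y, p (x + y) ≤ p x + p y) (hp_le : ∀ x, p x ≤ L * ‖x‖) (x : E) :
    ⨅ y : E, (f (x - y) + p y) ≤ p x := by
  have hbdd : BddBelow (Set.range fun y : E => f (x - y) + p y) :=
    ⟨_, Set.forall_mem_range.2 (le_add_of_quadratic_growth ha hf hsub hp_le x)⟩
  simpa [hf0] using ciInf_le hbdd x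

end InfimalConvolution

theorem recession_of_infimal_convolution
    {E : Type*} [NormedAddCommGroup E] [NormedSpace ℝ E]
    (a L : ℝ) (ha : 0 < a) (hL : 0 < L) (f p : E → ℝ)
    (hf0 : f 0 = 0) (hf : ∀ x, a * ‖x‖ ^ 2 ≤ f x)
    (hsub : ∀ x y, p (x + y) ≤ p x + p y)
    (hhom : ∀ t : ℝ, 0 ≤ t → ∀ x, p (t • x) = t * p x)
    (hp_nonneg : ∀ x, 0 ≤ p x) (hp_le : ∀ x, p x ≤ L * ‖x‖)
    (W : E → ℝ) (hW : ∀ x, W x = ⨅ y : E, (f (x - y) + p y)) :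
    ∀ ξ : E, Tendsto (fun t : ℝ => W (t • ξ) / t) atTop (nhds (p ξ)) := by
  intro ξ
  have hlim : Tendsto (fun t : ℝ => p ξ - L ^ 2 / (4 * a) / t) atTop (nhds (p ξ)) := by
    simpa using (tendsto_const_nhds (x := p ξ)).sub
      (tendsto_const_nhds (x := L ^ 2 / (4 * a)).div_atTop tendsto_id)
  refine tendsto_of_tendsto_of_tendsto_of_le_of_le' hlim tendsto_const_nhds ?_ ?_
  · filter_upwards [eventually_gt_atTop 0] with t ht
    have h := sub_le_infimal_convolution ha hf hsub hp_le (t • ξ)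
    rw [← hW, hhom t ht.le] at h
    rw [le_div_iff₀ ht, sub_mul, div_mul_cancel₀ _ ht.ne']
    linarith
  · filter_upwards [eventually_gt_atTop 0] with t ht
    have h := infimal_convolution_le ha hf0 hf hsub hp_le (t • ξ)
    rw [← hW, hhom t ht.le] at h
    rw [div_le_iff₀ ht]
    linarith
end

section
/- For every t ∈ ℝ, setting l* = max (β sin θ₀) (|t|·√(α/(2κ))), one has φ_{α,β}(t) = κ·l* + α·t²/(2·l*); moreover κ·l + α·t²/(2·l) ≥ φ_{α,β}(t) for every real l ≥ β sin θ₀. In other words, φ_{α,β}(t) is the minimum of l ↦ κ·l + α·t²/(2l) over l ≥ β sin θ₀, attained at l*. -/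
/-- The surface energy density in the intermediate regime between brittle
fracture and plasticity. -/
noncomputable def phi (α β κ θ₀ : ℝ) (t : ℝ) : ℝ :=
  if |t| ≤ β * Real.sin θ₀ * Real.sqrt (2 * κ / α) then
    α / (2 * β * Real.sin θ₀) * t ^ 2 + β * κ * Real.sin θ₀
  else Real.sqrt (2 * κ * α) * |t|

/-- On `[u, ∞)` the function `l ↦ l + u ^ 2 / l` is nondecreasing. -/
theorem add_sq_div_le_add_sq_div {m u l : ℝ} (hm : 0 < m) (hu : 0 ≤ u) (hum : u ≤ m)
    (hml : m ≤ l) : m + u ^ 2 / m ≤ l + u ^ 2 / l := by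
  have hl : 0 < l := hm.trans_le hml
  have hprod : u ^ 2 ≤ l * m := by nlinarith
  have key : l + u ^ 2 / l - (m + u ^ 2 / m) = (l - m) * (l * m - u ^ 2) / (l * m) := by
    field_simp
    ring
  have : 0 ≤ (l - m) * (l * m - u ^ 2) / (l * m) :=
    div_nonneg (mul_nonneg (sub_nonneg.2 hml) (sub_nonneg.2 hprod)) (by positivity)
  linarith

theorem two_mul_le_add_sq_div {u l : ℝ} (hl : 0 < l) : 2 * u ≤ l + u ^ 2 / l := by
  have key : l + u ^ 2 / l - 2 * u = (l - u) ^ 2 / l := by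
    field_simp
    ring
  have : 0 ≤ (l - u) ^ 2 / l := by positivity
  linarith

/-- The surface energy density in the rescaled variable `u = |t| * √(α / (2 * κ))`. -/
theorem phi_eq_rescaled {α β κ θ₀ : ℝ} (hα : 0 < α) (hβ : 0 < β) (hκ : 0 < κ)
    (hsin : 0 < Real.sin θ₀) (t : ℝ) :
    phi α β κ θ₀ t =
      if |t| * Real.sqrt (α / (2 * κ)) ≤ β * Real.sin θ₀ then
        κ * (β * Real.sin θ₀ + (|t| * Real.sqrt (α / (2 * κ))) ^ 2 / (β * Real.sin θ₀))
      else κ * (2 * (|t| * Real.sqrt (α / (2 * κ)))) := by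
  have hs : 0 < Real.sqrt (α / (2 * κ)) := Real.sqrt_pos.2 (by positivity)
  have hinv : Real.sqrt (2 * κ / α) = (Real.sqrt (α / (2 * κ)))⁻¹ := by
    rw [← Real.sqrt_inv, inv_div]
  have hprod : Real.sqrt (2 * κ * α) = 2 * κ * Real.sqrt (α / (2 * κ)) := by
    rw [show 2 * κ * α = (2 * κ) ^ 2 * (α / (2 * κ)) by field_simp,
      Real.sqrt_mul (by positivity), Real.sqrt_sq (by positivity)]
  have hiff : |t| ≤ β * Real.sin θ₀ * Real.sqrt (2 * κ / α) ↔
      |t| * Real.sqrt (α / (2 * κ)) ≤ β * Real.sin θ₀ := by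
    rw [hinv, ← div_eq_mul_inv, le_div_iff₀ hs]
  unfold phi
  simp only [hiff]
  split_ifs
  · rw [mul_pow, sq_abs, Real.sq_sqrt (by positivity)]
    field_simp
    ring
  · rw [hprod]
    ring

theorem phi_variational_formula
    (α β κ θ₀ : ℝ) (hα : 0 < α) (hβ : 0 < β) (hκ : 0 < κ)
    (hθ₀ : 0 < θ₀) (hθ₀' : θ₀ < Real.pi) :
    ∀ t : ℝ,
      phi α β κ θ₀ t =
        κ * max (β * Real.sin θ₀) (|t| * Real.sqrt (α / (2 * κ))) +
          α * t ^ 2 / (2 * max (β * Real.sin θ₀) (|t| * Real.sqrt (α / (2 * κ)))) ∧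
      ∀ l : ℝ, β * Real.sin θ₀ ≤ l →
        κ * l + α * t ^ 2 / (2 * l) ≥ phi α β κ θ₀ t := by
  intro t
  have hsin : 0 < Real.sin θ₀ := Real.sin_pos_of_pos_of_lt_pi hθ₀ hθ₀'
  rw [phi_eq_rescaled hα hβ hκ hsin]
  have henergy : ∀ l : ℝ, 0 < l → κ * l + α * t ^ 2 / (2 * l) =
      κ * (l + (|t| * Real.sqrt (α / (2 * κ))) ^ 2 / l) := by
    intro l hl
    rw [mul_pow, sq_abs, Real.sq_sqrt (by positivity)]
    field_simp
  have hu : 0 ≤ |t| * Real.sqrt (α / (2 * κ)) := by positivity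
  have hm : 0 < β * Real.sin θ₀ := mul_pos hβ hsin
  rw [henergy _ (lt_max_of_lt_left hm)]
  generalize |t| * Real.sqrt (α / (2 * κ)) = u at *
  generalize β * Real.sin θ₀ = m at *
  refine ⟨?_, fun l hl => ?_⟩
  · split_ifs with h
    · rw [max_eq_left h]
    · have hmu : m < u := not_le.1 h
      have : u ≠ 0 := (hm.trans hmu).ne'
      rw [max_eq_right hmu.le]
      field_simp
      ring
  · rw [henergy l (hm.trans_le hl), ge_iff_le]
    split_ifs with h
    · exact mul_le_mul_of_nonneg_left (add_sq_div_le_add_sq_div hm hu h hl) hκ.le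
    · exact mul_le_mul_of_nonneg_left (two_mul_le_add_sq_div (hm.trans_le hl)) hκ.le
end

section
/- Let ε > 0, let l be a real number with l ≥ ε, and let c ∈ ℝ. Then ε·c²/(2·l) + l/ε ≥ c²/2 + 1 if |c| ≤ √2, and ε·c²/(2·l) + l/ε ≥ √2·|c| if |c| > √2. -/
theorem one_dimensional_surface_lower_bound
    (ε : ℝ) (hε : 0 < ε) (l : ℝ) (hl : ε ≤ l) (c : ℝ) :
    (|c| ≤ Real.sqrt 2 → ε * c ^ 2 / (2 * l) + l / ε ≥ c ^ 2 / 2 + 1) ∧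
    (|c| > Real.sqrt 2 → ε * c ^ 2 / (2 * l) + l / ε ≥ Real.sqrt 2 * |c|) := by
  have hl0 : 0 < l := hε.trans_le hl
  have hsqrt : Real.sqrt 2 ^ 2 = 2 := Real.sq_sqrt (by norm_num)
  constructor
  · intro hc
    have hc2 : c ^ 2 ≤ 2 := by
      rw [← sq_abs, ← hsqrt]
      gcongr
    have hfactor : ε * c ^ 2 / (2 * l) + l / ε - (c ^ 2 / 2 + 1)
        = (l - ε) * (2 * l - ε * c ^ 2) / (2 * l * ε) := by
      field_simp
      ring
    have hnonneg : 0 ≤ (l - ε) * (2 * l - ε * c ^ 2) / (2 * l * ε) := by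
      have h₁ : 0 ≤ l - ε := sub_nonneg.mpr hl
      have h₂ : 0 ≤ 2 * l - ε * c ^ 2 := by nlinarith
      positivity
    linarith
  · intro _
    have hsquare : ε * c ^ 2 / (2 * l) + l / ε - Real.sqrt 2 * |c|
        = (ε * |c| - Real.sqrt 2 * l) ^ 2 / (2 * l * ε) := by
      rw [← sq_abs c]
      field_simp
      linear_combination (-l ^ 2) * hsqrt
    have hnonneg : 0 ≤ (ε * |c| - Real.sqrt 2 * l) ^ 2 / (2 * l * ε) := by positivity
    linarith
end

section
/- Let τ be a real 2×2 symmetric matrix (τ.IsSymm) with det τ ≤ 0. Then there exist vectors a, b ∈ ℝ² with ‖b‖ = 1 (Euclidean norm, i.e. (b 0)² + (b 1)² = 1) such that τ = (1/2) • (vecMulVec a b + vecMulVec b a), i.e. τ is the symmetrized tensor product a ⊙ b of a vector with a unit vector. -/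
theorem symm_matrix_nonpos_det_rank_one_decomposition
    (τ : Matrix (Fin 2) (Fin 2) ℝ) (hτ : τ.IsSymm) (hdet : τ.det ≤ 0) :
    ∃ a b : Fin 2 → ℝ, (b 0) ^ 2 + (b 1) ^ 2 = 1 ∧
      τ = (1 / 2 : ℝ) • (Matrix.vecMulVec a b + Matrix.vecMulVec b a) := by
  have hsymm : τ 1 0 = τ 0 1 := hτ.apply 0 1
  rw [Matrix.det_fin_two, hsymm] at hdet
  by_cases hp : τ 0 0 = 0
  · refine ⟨![2 * τ 0 1, τ 1 1], ![0, 1], by simp, ?_⟩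
    ext i j
    fin_cases i <;> fin_cases j <;> simp [hp, hsymm]
    ring
  · -- Factor the quadratic form of `τ` over its real roots, then normalize one factor.
    obtain ⟨s, hs⟩ : ∃ s : ℝ, s ^ 2 = τ 0 1 ^ 2 - τ 0 0 * τ 1 1 :=
      ⟨_, Real.sq_sqrt (by linarith)⟩
    obtain ⟨N, hN, hN2⟩ : ∃ N : ℝ, N ≠ 0 ∧ N ^ 2 = τ 0 0 ^ 2 + (τ 0 1 + s) ^ 2 :=
      ⟨√(τ 0 0 ^ 2 + (τ 0 1 + s) ^ 2), by positivity, Real.sq_sqrt (by positivity)⟩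
    refine ⟨![N, N * (τ 0 1 - s) / τ 0 0], ![τ 0 0 / N, (τ 0 1 + s) / N], ?_, ?_⟩
    · simp only [Matrix.cons_val_zero, Matrix.cons_val_one]
      field_simp
      exact hN2.symm
    · ext i j
      fin_cases i <;> fin_cases j <;> simp [hsymm] <;> field_simp <;>
        linarith
end

section
/- Let A, B, C be three affinely independent points of the Euclidean plane EuclideanSpace ℝ (Fin 2), let h > 0 be such that dist A B ≥ h, dist B C ≥ h and dist A C ≥ h, and let θ₀ > 0 be such that each of the three interior angles ∠BAC, ∠ABC, ∠ACB is at least θ₀. Then h · sin θ₀ · (dist A B + dist B C + dist A C) ≤ 6 · (volume (convexHull ℝ {A, B, C})).toReal; equivalently, the perimeter of the triangle is at most 6·(area)/(h·sin θ₀). -/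
open EuclideanGeometry MeasureTheory

/-- The open right triangle with legs `1` in the coordinate plane has area `1 / 2`. -/
lemma volume_regionBetween_zero_one_sub :
    volume (regionBetween (fun _ : ℝ => (0 : ℝ)) (fun x => 1 - x) (Set.Icc 0 1)) =
      ENNReal.ofReal (1 / 2) := by
  have hc : Continuous fun x : ℝ => 1 - x := by fun_prop
  have key := volume_regionBetween_eq_integral (μ := (volume : Measure ℝ))
    (f := fun _ : ℝ => (0 : ℝ)) (g := fun x => 1 - x) (s := Set.Icc 0 1)
    continuous_const.integrableOn_Icc hc.integrableOn_Icc measurableSet_Icc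
    (fun x hx => by linarith [hx.2])
  rw [Measure.volume_eq_prod, key, integral_Icc_eq_integral_Ioc,
    ← intervalIntegral.integral_of_le zero_le_one]
  congr 1
  simp only [Pi.sub_apply, sub_zero]
  rw [intervalIntegral.integral_sub (by simp) (by simp)]
  norm_num

/-- The area of a triangle is at least half the absolute value of the determinant of two of its
edge vectors. -/
lemma abs_det_le_two_mul_volume_convexHull (A B C : EuclideanSpace ℝ (Fin 2)) :
    |(B 0 - A 0) * (C 1 - A 1) - (C 0 - A 0) * (B 1 - A 1)| ≤
      2 * (volume (convexHull ℝ {A, B, C})).toReal := by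
  set T := convexHull ℝ ({A, B, C} : Set (EuclideanSpace ℝ (Fin 2))) with hT
  have hfin : volume T ≠ ⊤ := by
    have hb : Bornology.IsBounded T := by
      rw [hT, isBounded_convexHull]
      exact (Set.toFinite _).isBounded
    exact hb.measure_lt_top.ne
  let M : Matrix (Fin 2) (Fin 2) ℝ := !![B 0 - A 0, C 0 - A 0; B 1 - A 1, C 1 - A 1]
  let R := regionBetween (fun _ : ℝ => (0 : ℝ)) (fun x => 1 - x) (Set.Icc 0 1)
  let S : Set (Fin 2 → ℝ) := MeasurableEquiv.finTwoArrow ⁻¹' R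
  have hS : volume S = ENNReal.ofReal (1 / 2) := by
    rw [← volume_regionBetween_zero_one_sub]
    exact (volume_preserving_finTwoArrow ℝ).measure_preimage_equiv R
  have hsub : (fun x => A.ofLp + x) '' (Matrix.toLin' M '' S) ⊆
      (MeasurableEquiv.toLp 2 (Fin 2 → ℝ)) ⁻¹' T := by
    rintro _ ⟨_, ⟨x, hx, rfl⟩, rfl⟩
    obtain ⟨h0, h1, h2⟩ : x 0 ∈ Set.Icc (0 : ℝ) 1 ∧ 0 < x 1 ∧ x 1 < 1 - x 0 := hx
    rw [Set.mem_preimage, hT]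
    have hconv := convex_convexHull ℝ ({A, B, C} : Set (EuclideanSpace ℝ (Fin 2)))
    have hmem : ∀ P ∈ ({A, B, C} : Set (EuclideanSpace ℝ (Fin 2))),
        P ∈ convexHull ℝ ({A, B, C} : Set (EuclideanSpace ℝ (Fin 2))) :=
      fun P hP => subset_convexHull ℝ _ hP
    have := hconv.sum_mem (t := Finset.univ) (w := ![1 - x 0 - x 1, x 0, x 1])
      (z := ![A, B, C])
      (by intro i _; fin_cases i <;> simp <;> linarith [h0.1])
      (by simp [Fin.sum_univ_three]; ring)
      (by intro i _; fin_cases i <;> exact hmem _ (by simp))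
    convert this using 1
    ext i
    fin_cases i <;>
      simp [M, Fin.sum_univ_three, dotProduct, Fin.sum_univ_two, Matrix.vecHead, Matrix.vecTail] <;>
      ring
  have hle := measure_mono (μ := volume) hsub
  rw [(PiLp.volume_preserving_toLp (Fin 2)).measure_preimage_equiv T, Set.image_add_left,
    measure_preimage_add, Measure.addHaar_image_linearMap, hS, LinearMap.det_toLin',
    ← ENNReal.ofReal_mul (abs_nonneg _)] at hle
  have := (ENNReal.ofReal_le_iff_le_toReal hfin).1 hle
  rw [Matrix.det_fin_two_of] at this
  linarith

/-- The product of two sides of a triangle and the sine of the enclosed angle is at most twice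
the area. -/
lemma sin_angle_mul_dist_mul_dist_le (A B C : EuclideanSpace ℝ (Fin 2)) :
    Real.sin (∠ B A C) * (dist A B * dist A C) ≤
      2 * (volume (convexHull ℝ {A, B, C})).toReal := by
  refine le_trans (le_of_eq ?_) (abs_det_le_two_mul_volume_convexHull A B C)
  rw [dist_comm A B, dist_comm A C, dist_eq_norm, dist_eq_norm, EuclideanGeometry.angle,
    vsub_eq_sub, vsub_eq_sub, InnerProductGeometry.sin_angle_mul_norm_mul_norm,
    ← Real.sqrt_sq_eq_abs]
  congr 1
  simp only [PiLp.inner_apply, Fin.sum_univ_two, PiLp.sub_apply, RCLike.inner_apply, conj_trivial]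
  ring

theorem triangle_perimeter_le_area
    (A B C : EuclideanSpace ℝ (Fin 2))
    (hind : AffineIndependent ℝ ![A, B, C])
    (h : ℝ) (hh : 0 < h)
    (hAB : h ≤ dist A B) (hBC : h ≤ dist B C) (hAC : h ≤ dist A C)
    (θ₀ : ℝ) (hθ₀ : 0 < θ₀)
    (hangA : θ₀ ≤ ∠ B A C) (hangB : θ₀ ≤ ∠ A B C) (hangC : θ₀ ≤ ∠ A C B) :
    h * Real.sin θ₀ * (dist A B + dist B C + dist A C) ≤
      6 * (volume (convexHull ℝ {A, B, C})).toReal := by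
  have hsum : ∠ A B C + ∠ A C B + ∠ B A C = Real.pi := by
    have hne : B ≠ A := fun hBA => by
      rw [hBA, dist_self] at hAB
      linarith
    have := angle_add_angle_add_angle_eq_pi C hne
    rw [angle_comm B C A, angle_comm C A B] at this
    linarith
  have hs0 : 0 ≤ Real.sin θ₀ :=
    Real.sin_nonneg_of_nonneg_of_le_pi hθ₀.le (by linarith)
  have hsin : ∀ α, θ₀ ≤ α → α ≤ Real.pi - θ₀ → Real.sin θ₀ ≤ Real.sin α := by
    intro α h1 h2
    rcases le_total α (Real.pi / 2) with h3 | h3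
    · exact Real.sin_le_sin_of_le_of_le_pi_div_two (by linarith) h3 h1
    · rw [← Real.sin_pi_sub α]
      exact Real.sin_le_sin_of_le_of_le_pi_div_two (by linarith) (by linarith) (by linarith)
  have side : ∀ s t α : ℝ, h ≤ s → h ≤ t → θ₀ ≤ α → α ≤ Real.pi - θ₀ →
      h * Real.sin θ₀ * t ≤ Real.sin α * (s * t) := by
    intro s t α hs ht h1 h2
    have : h * Real.sin θ₀ ≤ s * Real.sin α :=
      mul_le_mul hs (hsin α h1 h2) hs0 (by linarith)
    nlinarith
  have eA := sin_angle_mul_dist_mul_dist_le A B C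
  have eB := sin_angle_mul_dist_mul_dist_le B A C
  have eC := sin_angle_mul_dist_mul_dist_le C A B
  rw [Set.insert_comm B A, dist_comm B A] at eB
  rw [Set.insert_comm C A, Set.pair_comm C B, dist_comm C A, dist_comm C B] at eC
  have sA := side (dist A C) (dist A B) _ hAC hAB hangA (by linarith)
  have sB := side (dist A B) (dist B C) _ hAB hBC hangB (by linarith)
  have sC := side (dist B C) (dist A C) _ hBC hAC hangC (by linarith)
  linarith
end

section
/- Let A, B, C be three affinely independent points of the Euclidean plane EuclideanSpace ℝ (Fin 2), let h > 0 be such that dist A B ≥ h, dist B C ≥ h and dist A C ≥ h, and let θ₀ > 0 be such that each of the three interior angles ∠BAC, ∠ABC, ∠ACB is at least θ₀. Then there exists a point x such that the closed ball Metric.closedBall x (h·sin θ₀/3) is contained in convexHull ℝ {A, B, C}. -/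
open EuclideanGeometry

/-- The planar cross product (signed area of the parallelogram spanned by `u` and `v`). -/
def planarCross (u v : EuclideanSpace ℝ (Fin 2)) : ℝ := u 0 * v 1 - u 1 * v 0

lemma abs_planarCross (u v : EuclideanSpace ℝ (Fin 2)) :
    |planarCross u v| = Real.sin (InnerProductGeometry.angle u v) * (‖u‖ * ‖v‖) := by
  rw [InnerProductGeometry.sin_angle_mul_norm_mul_norm, ← Real.sqrt_sq_eq_abs]
  congr 1
  simp only [planarCross, PiLp.inner_apply, Fin.sum_univ_two, RCLike.inner_apply, conj_trivial]
  ring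

lemma abs_planarCross_le (u v : EuclideanSpace ℝ (Fin 2)) : |planarCross u v| ≤ ‖u‖ * ‖v‖ := by
  rw [abs_planarCross]
  exact mul_le_of_le_one_left (by positivity) (Real.sin_le_one _)

lemma abs_planarCross_vsub (A B C : EuclideanSpace ℝ (Fin 2)) :
    |planarCross (B - A) (C - A)| = Real.sin (∠ B A C) * (dist A B * dist A C) := by
  rw [abs_planarCross, dist_comm A B, dist_comm A C, dist_eq_norm, dist_eq_norm]
  rfl

lemma Real.sin_le_sin_of_le_of_le_pi_sub {x y : ℝ} (hx : 0 ≤ x) (hxy : x ≤ y)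
    (hy : y ≤ Real.pi - x) : Real.sin x ≤ Real.sin y := by
  rcases le_total y (Real.pi / 2) with h | h
  · exact Real.sin_le_sin_of_le_of_le_pi_div_two (by linarith [Real.pi_pos]) h hxy
  · rw [← Real.sin_pi_sub y]
    exact Real.sin_le_sin_of_le_of_le_pi_div_two (by linarith [Real.pi_pos]) (by linarith)
      (by linarith)

lemma mem_convexHull_triple {E : Type*} [AddCommGroup E] [Module ℝ E] (A B C : E) {a b c : ℝ}
    (ha : 0 ≤ a) (hb : 0 ≤ b) (hc : 0 ≤ c) (habc : a + b + c = 1) :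
    a • A + b • B + c • C ∈ convexHull ℝ {A, B, C} := by
  have := (convex_convexHull ℝ {A, B, C}).sum_mem (t := Finset.univ) (w := ![a, b, c])
    (z := ![A, B, C]) (by simp [Fin.forall_fin_succ, ha, hb, hc])
    (by simpa [Fin.sum_univ_three] using habc)
    (by
      intro i _
      apply subset_convexHull
      fin_cases i <;> simp)
  simpa [Fin.sum_univ_three] using this

/-- If every altitude of a triangle is at least `3 * r`, the closed ball of radius `r` around the
centroid lies in the triangle. -/
lemma closedBall_centroid_subset_convexHull {A B C : EuclideanSpace ℝ (Fin 2)} {r : ℝ}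
    (hD : planarCross (B - A) (C - A) ≠ 0)
    (hA : 3 * r * dist B C ≤ |planarCross (B - A) (C - A)|)
    (hB : 3 * r * dist C A ≤ |planarCross (B - A) (C - A)|)
    (hC : 3 * r * dist A B ≤ |planarCross (B - A) (C - A)|) :
    Metric.closedBall ((1 / 3 : ℝ) • (A + B + C)) r ⊆ convexHull ℝ {A, B, C} := by
  intro p hp
  set D := planarCross (B - A) (C - A) with hDdef
  set d := p - (1 / 3 : ℝ) • (A + B + C) with hd
  have hdr : ‖d‖ ≤ r := by rwa [Metric.mem_closedBall, dist_eq_norm] at hp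
  have key (P Q : EuclideanSpace ℝ (Fin 2)) (hPQ : 3 * r * dist P Q ≤ |D|) :
      0 ≤ 1 / 3 + planarCross d (P - Q) / D := by
    have h1 : |planarCross d (P - Q) / D| ≤ 1 / 3 := by
      rw [abs_div, div_le_iff₀ (abs_pos.2 hD)]
      have h2 := abs_planarCross_le d (P - Q)
      rw [← dist_eq_norm P Q] at h2
      have h3 := mul_le_mul_of_nonneg_right hdr (dist_nonneg (x := P) (y := Q))
      linarith
    linarith [neg_abs_le (planarCross d (P - Q) / D)]
  have hmem := mem_convexHull_triple A B C (key B C hA) (key C A hB) (key A B hC) (by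
    field_simp
    simp only [planarCross, PiLp.sub_apply]
    ring)
  convert hmem using 1
  have hD' := hD
  rw [hDdef] at hD'
  simp only [planarCross, PiLp.sub_apply] at hD'
  ext i
  fin_cases i <;>
  · simp [hd, hDdef, planarCross]
    field_simp
    ring

theorem triangle_contains_ball
    (A B C : EuclideanSpace ℝ (Fin 2))
    (hind : AffineIndependent ℝ ![A, B, C])
    (h : ℝ) (hh : 0 < h)
    (hAB : h ≤ dist A B) (hBC : h ≤ dist B C) (hAC : h ≤ dist A C)
    (θ₀ : ℝ) (hθ₀ : 0 < θ₀)
    (hangA : θ₀ ≤ ∠ B A C) (hangB : θ₀ ≤ ∠ A B C) (hangC : θ₀ ≤ ∠ A C B) :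
    ∃ x : EuclideanSpace ℝ (Fin 2),
      Metric.closedBall x (h * Real.sin θ₀ / 3) ⊆ convexHull ℝ {A, B, C} := by
  have hne : B ≠ A := (dist_pos.1 (hh.trans_le hAB)).symm
  have hsum := angle_add_angle_add_angle_eq_pi C hne
  rw [angle_comm B C A, angle_comm C A B] at hsum
  have hsin : 0 < Real.sin θ₀ := Real.sin_pos_of_pos_of_lt_pi hθ₀ (by linarith)
  have sA := Real.sin_le_sin_of_le_of_le_pi_sub hθ₀.le hangA (by linarith)
  have sB := Real.sin_le_sin_of_le_of_le_pi_sub hθ₀.le hangB (by linarith)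
  have eA := abs_planarCross_vsub A B C
  have eB : |planarCross (B - A) (C - A)| = Real.sin (∠ A B C) * (dist A B * dist B C) := by
    rw [dist_comm A B, ← abs_planarCross_vsub B A C, ← abs_neg]
    congr 1
    simp only [planarCross, PiLp.sub_apply]
    ring
  have bound {s x y : ℝ} (hs : Real.sin θ₀ ≤ s) (hx : h ≤ x) (hy : 0 ≤ y) :
      3 * (h * Real.sin θ₀ / 3) * y ≤ s * (x * y) := by
    have := hsin.le.trans hs
    calc 3 * (h * Real.sin θ₀ / 3) * y = Real.sin θ₀ * (h * y) := by ring
      _ ≤ s * (x * y) := by gcongr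
  refine ⟨_, closedBall_centroid_subset_convexHull ?_ ?_ ?_ ?_⟩
  · rw [← abs_pos, eA]
    have := hsin.trans_le sA
    have := hh.trans_le hAB
    have := hh.trans_le hAC
    positivity
  · rw [eB]
    exact bound sB hAB dist_nonneg
  · rw [eA, dist_comm C A]
    exact bound sA hAB dist_nonneg
  · rw [eA, mul_comm (dist A B)]
    exact bound sA hAC dist_nonneg
end

section
/- Let A, B, C be three affinely independent points of the Euclidean plane EuclideanSpace ℝ (Fin 2), let h > 0 be such that dist A B ≥ h, dist B C ≥ h and dist A C ≥ h, and let θ₀ > 0 be such that each of the three interior angles ∠BAC, ∠ABC, ∠ACB is at least θ₀. Then (volume (convexHull ℝ {A, B, C})).toReal ≥ (1/2) · h · max (dist A B) (max (dist B C) (dist A C)) · sin θ₀. -/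
open EuclideanGeometry MeasureTheory

/-- The closed right triangle spanned by the standard basis is cut out by three inequalities. -/
lemma convexHull_zero_single_single :
    convexHull ℝ {0, EuclideanSpace.single 0 1, EuclideanSpace.single 1 1} =
      {x : EuclideanSpace ℝ (Fin 2) | 0 ≤ x 0 ∧ 0 ≤ x 1 ∧ x 0 + x 1 ≤ 1} := by
  apply Set.Subset.antisymm
  · refine convexHull_min ?_ ?_
    · rintro x (rfl | rfl | rfl) <;> simp
    · rintro x ⟨hx0, hx1, hx⟩ y ⟨hy0, hy1, hy⟩ a b ha hb hab
      refine ⟨?_, ?_, ?_⟩ <;> simp only [PiLp.add_apply, PiLp.smul_apply, smul_eq_mul]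
      · positivity
      · positivity
      · nlinarith
  · rintro x ⟨hx0, hx1, hx⟩
    have hsum : x = (1 - x 0 - x 1) • (0 : EuclideanSpace ℝ (Fin 2)) +
        (x 0 • EuclideanSpace.single 0 1 + x 1 • EuclideanSpace.single 1 1) := by
      ext i
      fin_cases i <;> simp
    rw [convexHull_insert (Set.insert_nonempty _ _), convexHull_pair, convexJoin_singleton_left]
    rcases (add_nonneg hx0 hx1).eq_or_lt with h0 | h0
    · have h0' : x 0 = 0 := by linarith
      have h1' : x 1 = 0 := by linarith
      have hx' : x = 0 := by
        ext i
        fin_cases i <;> simp [h0', h1']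
      rw [hx']
      exact Set.mem_biUnion (left_mem_segment ℝ _ _) (left_mem_segment ℝ _ _)
    · refine Set.mem_biUnion (x := (x 0 / (x 0 + x 1)) • EuclideanSpace.single 0 1 +
        (x 1 / (x 0 + x 1)) • EuclideanSpace.single 1 1)
        ⟨_, _, by positivity, by positivity, by field_simp, rfl⟩
        ⟨1 - x 0 - x 1, x 0 + x 1, by linarith, by linarith, by ring, ?_⟩
      rw [smul_add, smul_smul, smul_smul, mul_div_cancel₀ _ h0.ne', mul_div_cancel₀ _ h0.ne']
      exact hsum.symm

lemma volume_convexHull_zero_single_single :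
    volume (convexHull ℝ {(0 : EuclideanSpace ℝ (Fin 2)), EuclideanSpace.single 0 1,
      EuclideanSpace.single 1 1}) = ENNReal.ofReal (1 / 2) := by
  let S : Set (ℝ × ℝ) := {p | p.1 ∈ Set.Icc 0 1 ∧ p.2 ∈ Set.Icc 0 (1 - p.1)}
  have hS : MeasurableSet S :=
    measurableSet_region_between_cc measurable_const (measurable_const.sub measurable_id)
      measurableSet_Icc
  have hpre : convexHull ℝ {(0 : EuclideanSpace ℝ (Fin 2)), EuclideanSpace.single 0 1,
      EuclideanSpace.single 1 1} =
      (MeasurableEquiv.finTwoArrow ∘ WithLp.ofLp (p := 2) (V := Fin 2 → ℝ)) ⁻¹' S := by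
    rw [convexHull_zero_single_single]
    ext x
    simp only [S, Set.mem_ofPred_eq, Set.mem_preimage, Function.comp_apply,
      MeasurableEquiv.finTwoArrow, MeasurableEquiv.piFinTwo_apply, Set.mem_Icc]
    constructor
    · rintro ⟨h0, h1, h⟩
      exact ⟨⟨h0, by linarith⟩, h1, by linarith⟩
    · rintro ⟨⟨h0, -⟩, h1, h⟩
      exact ⟨h0, h1, by linarith⟩
  rw [hpre, ((volume_preserving_finTwoArrow ℝ).comp
    (PiLp.volume_preserving_ofLp (Fin 2))).measure_preimage hS.nullMeasurableSet,
    Measure.volume_eq_prod, Measure.prod_apply hS]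
  have hslice : ∀ x : ℝ, volume (Prod.mk x ⁻¹' S) =
      (Set.Icc (0 : ℝ) 1).indicator (fun x => ENNReal.ofReal (1 - x)) x := by
    intro x
    by_cases hx : x ∈ Set.Icc (0 : ℝ) 1
    · have : Prod.mk x ⁻¹' S = Set.Icc 0 (1 - x) := by
        ext y
        exact and_iff_right hx
      rw [this, Real.volume_Icc, sub_zero, Set.indicator_of_mem hx]
    · have : Prod.mk x ⁻¹' S = ∅ := by
        ext y
        exact iff_of_false (fun h => hx h.1) (Set.notMem_empty y)
      rw [this, measure_empty, Set.indicator_of_notMem hx]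
  simp_rw [hslice]
  have hint : ∫ x in Set.Icc (0 : ℝ) 1, (1 - x) = 1 / 2 := by
    rw [integral_Icc_eq_integral_Ioc, ← intervalIntegral.integral_of_le zero_le_one]
    rw [intervalIntegral.integral_sub intervalIntegrable_const intervalIntegral.intervalIntegrable_id,
      integral_id, intervalIntegral.integral_const]
    norm_num
  rw [lintegral_indicator measurableSet_Icc, ← hint, ofReal_integral_eq_lintegral_ofReal]
  · exact (continuous_const.sub continuous_id).continuousOn.integrableOn_Icc
  · filter_upwards [ae_restrict_mem measurableSet_Icc] with x hx
    exact sub_nonneg.2 hx.2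

/-- The shoelace formula for the area of a triangle. -/
lemma volume_convexHull_triple (A B C : EuclideanSpace ℝ (Fin 2)) :
    volume (convexHull ℝ {A, B, C}) = ENNReal.ofReal
      (1 / 2 * |(B 0 - A 0) * (C 1 - A 1) - (C 0 - A 0) * (B 1 - A 1)|) := by
  let M : Matrix (Fin 2) (Fin 2) ℝ := !![B 0 - A 0, C 0 - A 0; B 1 - A 1, C 1 - A 1]
  let f : EuclideanSpace ℝ (Fin 2) →ₗ[ℝ] EuclideanSpace ℝ (Fin 2) := Matrix.toLpLin 2 2 M
  have himage : convexHull ℝ {A, B, C} = (fun x => A + x) '' (f '' convexHull ℝ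
      {0, EuclideanSpace.single 0 1, EuclideanSpace.single 1 1}) := by
    have hB : A + f (EuclideanSpace.single 0 1) = B := by
      ext i
      fin_cases i <;> simp [f, M, Matrix.toLpLin_apply]
    have hC : A + f (EuclideanSpace.single 1 1) = C := by
      ext i
      fin_cases i <;> simp [f, M, Matrix.toLpLin_apply]
    rw [f.image_convexHull]
    change _ = (A +ᵥ ·) '' _
    rw [Set.image_vadd, ← convexHull_vadd, ← Set.image_vadd]
    simp only [Set.image_insert_eq, Set.image_singleton, map_zero, vadd_eq_add, add_zero, hB, hC]
  have hdet : LinearMap.det f =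
      (B 0 - A 0) * (C 1 - A 1) - (C 0 - A 0) * (B 1 - A 1) := by
    simp [f, M, Matrix.det_fin_two]
  rw [himage, Set.image_add_left, measure_preimage_add, Measure.addHaar_image_linearMap,
    volume_convexHull_zero_single_single, hdet, ← ENNReal.ofReal_mul (abs_nonneg _), mul_comm]

/-- The area of a triangle is half the product of two sides and the sine of the angle between
them. -/
lemma toReal_volume_convexHull_triple (A B C : EuclideanSpace ℝ (Fin 2)) :
    (volume (convexHull ℝ {A, B, C})).toReal =
      1 / 2 * (dist A B * dist A C * Real.sin (∠ B A C)) := by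
  rw [volume_convexHull_triple, ENNReal.toReal_ofReal (by positivity), dist_comm A B,
    dist_comm A C, dist_eq_norm_vsub (EuclideanSpace ℝ (Fin 2)) B A,
    dist_eq_norm_vsub (EuclideanSpace ℝ (Fin 2)) C A, EuclideanGeometry.angle, mul_comm (_ * _),
    InnerProductGeometry.sin_angle_mul_norm_mul_norm, ← Real.sqrt_sq_eq_abs]
  congr 2
  simp only [PiLp.inner_apply, Fin.sum_univ_two, vsub_eq_sub, PiLp.sub_apply, RCLike.inner_apply,
    conj_trivial]
  ring

/-- One of two angles of a triangle is at most a right angle, and the altitude onto their common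
side is bounded below using that angle. -/
lemma half_mul_dist_mul_sin_le_volume {A B C : EuclideanSpace ℝ (Fin 2)} {h θ : ℝ}
    (hAB : A ≠ B) (hBC : h ≤ dist B C) (hAC : h ≤ dist A C) (hθ : 0 ≤ θ)
    (hA : θ ≤ ∠ B A C) (hB : θ ≤ ∠ A B C) :
    1 / 2 * h * dist A B * Real.sin θ ≤ (volume (convexHull ℝ {A, B, C})).toReal := by
  wlog hle : ∠ B A C ≤ ∠ A B C generalizing A B
  · rw [dist_comm, Set.insert_comm]
    exact this hAB.symm hAC hBC hB hA (le_of_not_ge hle)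
  have hsum := angle_add_angle_add_angle_eq_pi C hAB.symm
  have hpi := angle_nonneg B C A
  rw [angle_comm C A B] at hsum
  have hsin : Real.sin θ ≤ Real.sin (∠ B A C) :=
    Real.sin_le_sin_of_le_of_le_pi_div_two (by linarith [Real.pi_pos]) (by linarith) hA
  have hsin0 : 0 ≤ Real.sin θ :=
    Real.sin_nonneg_of_nonneg_of_le_pi hθ (hA.trans (angle_le_pi _ _ _))
  rw [toReal_volume_convexHull_triple]
  calc 1 / 2 * h * dist A B * Real.sin θ = 1 / 2 * (dist A B * h * Real.sin θ) := by ring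
    _ ≤ _ := by gcongr

theorem triangle_area_lower_bound
    (A B C : EuclideanSpace ℝ (Fin 2))
    (hind : AffineIndependent ℝ ![A, B, C])
    (h : ℝ) (hh : 0 < h)
    (hAB : h ≤ dist A B) (hBC : h ≤ dist B C) (hAC : h ≤ dist A C)
    (θ₀ : ℝ) (hθ₀ : 0 < θ₀)
    (hangA : θ₀ ≤ ∠ B A C) (hangB : θ₀ ≤ ∠ A B C) (hangC : θ₀ ≤ ∠ A C B) :
    (volume (convexHull ℝ {A, B, C})).toReal ≥
      (1 / 2) * h * max (dist A B) (max (dist B C) (dist A C)) * Real.sin θ₀ := by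
  have hAB' : A ≠ B := dist_pos.1 (hh.trans_le hAB)
  have hBC' : B ≠ C := dist_pos.1 (hh.trans_le hBC)
  have hAC' : A ≠ C := dist_pos.1 (hh.trans_le hAC)
  have hc := half_mul_dist_mul_sin_le_volume hAB' hBC hAC hθ₀.le hangA hangB
  have hb := half_mul_dist_mul_sin_le_volume hAC' (dist_comm B C ▸ hBC) hAB hθ₀.le
    (angle_comm B A C ▸ hangA) hangC
  have ha := half_mul_dist_mul_sin_le_volume hBC' (dist_comm A C ▸ hAC)
    (dist_comm A B ▸ hAB) hθ₀.le (angle_comm A B C ▸ hangB) (angle_comm A C B ▸ hangC)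
  rw [Set.pair_comm C B] at hb
  rw [Set.pair_comm C A, Set.insert_comm B A] at ha
  rcases max_choice (dist A B) (max (dist B C) (dist A C)) with hm | hm
  · rwa [hm]
  · rw [hm]
    rcases max_choice (dist B C) (dist A C) with hm' | hm' <;> rwa [hm']
end

section
/- Let a₀ > 0, a₁ > 0, ε > 0 with ε·a₀ < a₁, and ξ ∈ ℝ. Define F : ℝ → ℝ by F(θ) = θ/ε + ξ²/(2·(θ/(ε·a₀) + (1 − θ)/a₁)). Then: (i) if a₁²·ξ² ≤ 2·a₀, then F(0) ≤ F(θ) for every θ ∈ [0, 1]; (ii) setting θ* = ε·√(a₀·a₁/(2·(a₁ − ε·a₀)))·(|ξ| − √(2·a₀/(a₁·(a₁ − ε·a₀)))), if 0 ≤ θ* ≤ 1 then F(θ*) ≤ F(θ) for every θ ∈ [0, 1]. -/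
/-- The function `D ↦ D / m + x / D` is minimised on the positive half-line where `D ^ 2 = m * x`. -/
theorem div_add_div_le_of_sq_eq {m x s D : ℝ} (hm : 0 < m) (hD : 0 < D)
    (h : s ^ 2 = m * x) : s / m + x / s ≤ D / m + x / D := by
  have hx : x = s ^ 2 / m := by rw [h]; field_simp
  have key : D / m + x / D - (s / m + x / s) = (D - s) ^ 2 / (m * D) := by
    rw [hx]; field_simp; ring
  have : 0 ≤ (D - s) ^ 2 / (m * D) := by positivity
  linarith

/-- The function `D ↦ D / m + x / D` is nondecreasing past `s` as soon as `m * x ≤ s ^ 2`. -/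
theorem div_add_div_le_of_le_sq {m x s D : ℝ} (hm : 0 < m) (hs : 0 < s) (hsD : s ≤ D)
    (h : m * x ≤ s ^ 2) : s / m + x / s ≤ D / m + x / D := by
  have hD : 0 < D := hs.trans_le hsD
  have key : D / m + x / D - (s / m + x / s) = (D - s) * (s * D - m * x) / (m * s * D) := by
    field_simp; ring
  have h₁ : 0 ≤ s * D - m * x := by nlinarith
  have h₂ : 0 ≤ D - s := by linarith
  have : 0 ≤ (D - s) * (s * D - m * x) / (m * s * D) := by positivity
  linarith

theorem optimal_volume_fraction_1d
    (a₀ a₁ ε ξ : ℝ) (ha₀ : 0 < a₀) (ha₁ : 0 < a₁) (hε : 0 < ε)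
    (hεa : ε * a₀ < a₁)
    (F : ℝ → ℝ)
    (hF : ∀ θ : ℝ, F θ = θ / ε + ξ ^ 2 / (2 * (θ / (ε * a₀) + (1 - θ) / a₁))) :
    (a₁ ^ 2 * ξ ^ 2 ≤ 2 * a₀ → ∀ θ ∈ Set.Icc (0 : ℝ) 1, F 0 ≤ F θ) ∧
    (∀ θstar : ℝ,
      θstar = ε * Real.sqrt (a₀ * a₁ / (2 * (a₁ - ε * a₀))) *
        (|ξ| - Real.sqrt (2 * a₀ / (a₁ * (a₁ - ε * a₀)))) →
      0 ≤ θstar → θstar ≤ 1 → ∀ θ ∈ Set.Icc (0 : ℝ) 1, F θstar ≤ F θ) := by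
  obtain ⟨c, hc⟩ : ∃ c, c = a₁ - ε * a₀ := ⟨_, rfl⟩
  have hc₀ : 0 < c := by linarith
  rw [← hc]
  obtain ⟨m, hm⟩ : ∃ m, m = c / (a₀ * a₁) := ⟨_, rfl⟩
  have hm₀ : 0 < m := by rw [hm]; positivity
  obtain ⟨D, hD⟩ : ∃ D : ℝ → ℝ, ∀ θ, D θ = 1 / a₁ + m / ε * θ := ⟨_, fun _ => rfl⟩
  have hFD (θ : ℝ) : F θ = D θ / m + ξ ^ 2 / 2 / D θ - 1 / a₁ / m := by
    have h₁ : θ / (ε * a₀) + (1 - θ) / a₁ = D θ := by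
      rw [hD, hm, hc]; field_simp; ring
    have h₂ : θ / ε = D θ / m - 1 / a₁ / m := by
      rw [hD]; field_simp; ring
    rw [hF, h₁, h₂, div_div]; ring
  have hD_zero : D 0 = 1 / a₁ := by simp [hD]
  have hD_le {θ : ℝ} (hθ : 0 ≤ θ) : 1 / a₁ ≤ D θ := by
    rw [hD]
    have : 0 ≤ m / ε * θ := by positivity
    linarith
  have hD_pos {θ : ℝ} (hθ : 0 ≤ θ) : 0 < D θ := (by positivity : 0 < 1 / a₁).trans_le (hD_le hθ)
  refine ⟨fun h θ hθ => ?_, fun θstar hstar _ _ θ hθ => ?_⟩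
  · rw [hFD, hFD, sub_le_sub_iff_right]
    refine div_add_div_le_of_le_sq hm₀ (hD_pos le_rfl) (hD_zero ▸ hD_le hθ.1) ?_
    have hca : c ≤ a₁ := by
      have := mul_pos hε ha₀
      linarith
    rw [hD_zero, hm, div_pow, one_pow, le_div_iff₀ (by positivity)]
    calc c / (a₀ * a₁) * (ξ ^ 2 / 2) * a₁ ^ 2
        = c / (a₀ * a₁) / 2 * (a₁ ^ 2 * ξ ^ 2) := by ring
      _ ≤ c / (a₀ * a₁) / 2 * (2 * a₀) := by gcongr
      _ = c / a₁ := by field_simp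
      _ ≤ 1 := (div_le_one ha₁).2 hca
  · rw [hFD, hFD, sub_le_sub_iff_right]
    refine div_add_div_le_of_sq_eq hm₀ (hD_pos hθ.1) ?_
    have hprod : √(a₀ * a₁ / (2 * c)) * √(2 * a₀ / (a₁ * c)) = a₀ / c := by
      rw [← Real.sqrt_mul (by positivity), Real.sqrt_eq_iff_mul_self_eq (by positivity)
        (by positivity)]
      field_simp
    have hsq : √(a₀ * a₁ / (2 * c)) ^ 2 = a₀ * a₁ / (2 * c) := Real.sq_sqrt (by positivity)
    have hDstar : D θstar = m * √(a₀ * a₁ / (2 * c)) * |ξ| := by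
      have : θstar = ε * (√(a₀ * a₁ / (2 * c)) * |ξ| - a₀ / c) := by
        rw [hstar, ← hprod]; ring
      rw [hD, this, hm]; field_simp; ring
    rw [hDstar, mul_pow, mul_pow, hsq, sq_abs, hm]
    field_simp
end
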